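/- Let d ≥ 2, let Ω ⊂ ℝ^d be a bounded convex open set, let u : ℝ^d → ℝ be of class C⁴ with D²u(x) positive definite for all x ∈ cl(Ω), and set f = det D²u. Then there exist C₁ > 0 and h₀ ∈ (0,1), independent of h, α and ν, such that for all 0 < h ≤ h₀, all α > 0 and all ν > 0 the following holds: if z_h : ℤ_h → ℝ satisfies z_h(x) = α u(x) for all x ∈ ℤ_h \ Ω_h⁰ and −ν Δ_h z_h(x) = −ν α Δ_h(r_h u)(x) + α^d ( (1/d) div_h[(cof sym H_d(r_h u)) D_h(r_h u)](x) − f(x) ) for all x ∈ Ω_h⁰, then |z_h − α r_h u|_{1,h} ≤ (C₁/ν) α^d h. -/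

import Mathlib

noncomputable section

namespace MA

variable {d : ℕ}

/-- the `i`-th standard basis vector of `ℝ^d`. -/
def bv (d : ℕ) (i : Fin d) : Fin d → ℝ := Pi.single i 1

def lamMin (A : Matrix (Fin d) (Fin d) ℝ) : ℝ := sInf (spectrum ℝ A)

def lamMax (A : Matrix (Fin d) (Fin d) ℝ) : ℝ := sSup (spectrum ℝ A)

def symPart (A : Matrix (Fin d) (Fin d) ℝ) : Matrix (Fin d) (Fin d) ℝ :=
  (1 / 2 : ℝ) • (A + A.transpose)

/-- the cofactor matrix: `Aᵀ * cof A = det A • 1`. -/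
def cof (A : Matrix (Fin d) (Fin d) ℝ) : Matrix (Fin d) (Fin d) ℝ :=
  (Matrix.adjugate A).transpose

/-- forward difference quotient `∂₊^i`. -/
def dp (h : ℝ) (i : Fin d) (v : (Fin d → ℝ) → ℝ) (x : Fin d → ℝ) : ℝ :=
  (v (x + h • bv d i) - v x) / h

/-- backward difference quotient `∂₋^i`. -/
def dm (h : ℝ) (i : Fin d) (v : (Fin d → ℝ) → ℝ) (x : Fin d → ℝ) : ℝ :=
  (v x - v (x - h • bv d i)) / h

/-- the discrete Hessian `H_d(v)(x)` with entries `∂₋^j ∂₊^i v(x)`. -/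
def Hd (h : ℝ) (v : (Fin d → ℝ) → ℝ) (x : Fin d → ℝ) : Matrix (Fin d) (Fin d) ℝ :=
  Matrix.of fun i j => dm h j (fun y => dp h i v y) x

/-- the discrete Hessian `Ĥ_d(v)(x)` with entries `∂₋^j ∂₋^i v(x)`. -/
def Hhat (h : ℝ) (v : (Fin d → ℝ) → ℝ) (x : Fin d → ℝ) : Matrix (Fin d) (Fin d) ℝ :=
  Matrix.of fun i j => dm h j (fun y => dm h i v y) x

/-- the central discrete Hessian `H̄_d(v)(x)`. -/
def Hc (h : ℝ) (v : (Fin d → ℝ) → ℝ) (x : Fin d → ℝ) : Matrix (Fin d) (Fin d) ℝ :=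
  Matrix.of fun i j =>
    if i = j then (v (x + h • bv d i) - 2 * v x + v (x - h • bv d i)) / h ^ 2
    else (v (x + h • bv d i + h • bv d j) - v (x + h • bv d i - h • bv d j)
          - v (x - h • bv d i + h • bv d j) + v (x - h • bv d i - h • bv d j)) / (4 * h ^ 2)

/-- the discrete gradient `D_h v = (∂₊^1 v, …, ∂₊^d v)`. -/
def Dh (h : ℝ) (v : (Fin d → ℝ) → ℝ) (x : Fin d → ℝ) : Fin d → ℝ := fun i => dp h i v x

/-- the discrete divergence `div_h w = Σ_i ∂₋^i w_i`. -/
def divh (h : ℝ) (w : (Fin d → ℝ) → Fin d → ℝ) (x : Fin d → ℝ) : ℝ :=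
  ∑ i, dm h i (fun y => w y i) x

/-- the discrete Laplacian `Δ_h v = Σ_i ∂₊^i ∂₋^i v`. -/
def lapH (h : ℝ) (v : (Fin d → ℝ) → ℝ) (x : Fin d → ℝ) : ℝ :=
  ∑ i, dp h i (fun y => dm h i v y) x

/-- the grid `ℤ_h = {x : x_i / h ∈ ℤ}`. -/
def gridZ (d : ℕ) (h : ℝ) : Set (Fin d → ℝ) := {x | ∀ i, ∃ k : ℤ, x i = (k : ℝ) * h}

/-- `Ω_h = cl(Ω) ∩ ℤ_h`. -/
def OmegaH (Ω : Set (Fin d → ℝ)) (h : ℝ) : Set (Fin d → ℝ) := closure Ω ∩ gridZ d h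

/-- `Ω_h⁰ = {x ∈ Ω_h : x ± h e_i ± h e_j ∈ cl(Ω) for all i,j}`. -/
def OmegaH0 (Ω : Set (Fin d → ℝ)) (h : ℝ) : Set (Fin d → ℝ) :=
  {x | x ∈ OmegaH Ω h ∧ ∀ i j : Fin d, ∀ s t : Bool,
    x + (if s then h else -h) • bv d i + (if t then h else -h) • bv d j ∈ closure Ω}

/-- the discrete seminorm `|v|_{1,h}`. -/
def snorm1h (Ω : Set (Fin d → ℝ)) (h : ℝ) (v : (Fin d → ℝ) → ℝ) : ℝ :=
  Real.sqrt (∑ i : Fin d, h ^ d * ∑ᶠ x ∈ OmegaH0 Ω h, (dp h i v x) ^ 2)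

/-- the Hessian matrix `D²v(x)` of second partial derivatives. -/
def hess (v : (Fin d → ℝ) → ℝ) (x : Fin d → ℝ) : Matrix (Fin d) (Fin d) ℝ :=
  Matrix.of fun i j => iteratedFDeriv ℝ 2 v x ![bv d i, bv d j]

/-- the compatible discrete Monge–Ampère operator
`(1/d) div_h [(cof sym H_d v) D_h v]`. -/
def MAh (h : ℝ) (v : (Fin d → ℝ) → ℝ) (x : Fin d → ℝ) : ℝ :=
  (1 / (d : ℝ)) * divh h (fun y => (cof (symPart (Hd h v y))).mulVec (Dh h v y)) x

end MA

namespace MA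

variable {d : ℕ}

/-! ### Determinants and null Lagrangians -/

theorem cof_mulVec_apply (A : Matrix (Fin d) (Fin d) ℝ) (p : Fin d → ℝ) (i : Fin d) :
    (cof A).mulVec p i = (A.updateRow i p).det := by
  rw [cof, Matrix.adjugate_transpose, ← Matrix.cramer_eq_adjugate_mulVec,
    Matrix.cramer_transpose_apply]

theorem sum_eq_zero_of_antisymm {ι : Type*} [Fintype ι] {F : ι → ι → ℝ}
    (hF : ∀ i k, F i k = -F k i) : ∑ i, ∑ k, F i k = 0 := by
  have h : ∑ i, ∑ k, F i k = -∑ i, ∑ k, F i k := by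
    conv_lhs => rw [Finset.sum_comm]
    simp only [← Finset.sum_neg_distrib]
    exact Finset.sum_congr rfl fun i _ => Finset.sum_congr rfl fun k _ => hF k i
  linarith

/-- The algebraic form of the divergence-free property of the rows of the cofactor matrix of a
Hessian: `T i k` plays the role of `∂ᵢ` of the `k`-th row of the Hessian. -/
theorem sum_det_updateRow_updateRow (A : Matrix (Fin d) (Fin d) ℝ) (p : Fin d → ℝ)
    (T : Fin d → Fin d → Fin d → ℝ) (hT : ∀ i k, T i k = T k i) :
    ∑ i, ∑ k, ((A.updateRow i p).updateRow k (if k = i then A i else T i k)).det =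
      d * A.det := by
  have hsplit : ∀ i k, ((A.updateRow i p).updateRow k (if k = i then A i else T i k)).det =
      (if k = i then A.det else 0) +
        (if k = i then 0 else ((A.updateRow i p).updateRow k (T i k)).det) := by
    intro i k
    by_cases hk : k = i
    · subst hk
      simp
    · simp [hk]
  simp only [hsplit, Finset.sum_add_distrib]
  rw [sum_eq_zero_of_antisymm (F := fun i k =>
    if k = i then 0 else ((A.updateRow i p).updateRow k (T i k)).det)]
  · simp
  · intro i k
    by_cases hk : k = i
    · simp [hk]
    · have hk' : i ≠ k := fun h => hk h.symm
      simp only [hk, hk', if_false]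
      have hswap := Matrix.detRowAlternating.map_swap
        (v := (A.updateRow k p).updateRow i (T k i)) hk'
      change Matrix.det _ = - Matrix.det _ at hswap
      rw [← hswap]
      congr 1
      ext a b
      simp only [Matrix.updateRow_apply, Function.comp]
      by_cases ha : a = k
      · subst ha
        simp [hT i a]
      · by_cases hb : a = i
        · subst hb
          simp [hk]
          simp [hk']
        · simp [Equiv.swap_apply_of_ne_of_ne hb ha, ha, hb]

/-- The determinant as a continuous multilinear function of the rows. -/
def detRows (d : ℕ) : ContinuousMultilinearMap ℝ (fun _ : Fin d => Fin d → ℝ) ℝ :=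
  ⟨(Matrix.detRowAlternating (n := Fin d) (R := ℝ)).toMultilinearMap,
    Continuous.matrix_det continuous_id⟩

theorem fderiv_detRows (A T : Fin d → Fin d → ℝ) :
    fderiv ℝ (detRows d) A T = ∑ k, ((Matrix.of A).updateRow k (T k)).det := by
  rw [(ContinuousMultilinearMap.hasFDerivAt (detRows d) A).fderiv,
    ContinuousMultilinearMap.linearDeriv_apply]
  rfl

/-! ### First order expansions -/

section Calculus

variable {V : Type*} [NormedAddCommGroup V] [NormedSpace ℝ V] [FiniteDimensional ℝ V]

theorem exists_bound_closedBall {W : Type*} [NormedAddCommGroup W] {g : V → W}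
    (hg : Continuous g) (R : ℝ) :
    ∃ L, 0 ≤ L ∧ ∀ x, ‖x‖ ≤ R → ‖g x‖ ≤ L := by
  have := FiniteDimensional.proper_real V
  obtain ⟨L, hL⟩ := (isCompact_closedBall (0 : V) R).exists_bound_of_continuousOn hg.continuousOn
  exact ⟨max L 0, le_max_right _ _, fun x hx => (hL x (by simpa using hx)).trans (le_max_left _ _)⟩

theorem exists_lipschitz_closedBall {W : Type*} [NormedAddCommGroup W] [NormedSpace ℝ W]
    {g : V → W} (hg : ContDiff ℝ 1 g) (R : ℝ) :
    ∃ L, 0 ≤ L ∧ ∀ x y, ‖x‖ ≤ R → ‖y‖ ≤ R → ‖g x - g y‖ ≤ L * ‖x - y‖ := by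
  obtain ⟨L, hL0, hL⟩ := exists_bound_closedBall (hg.continuous_fderiv one_ne_zero) R
  refine ⟨L, hL0, fun x y hx hy => ?_⟩
  exact (convex_closedBall (0 : V) R).norm_image_sub_le_of_norm_fderiv_le
    (fun z _ => (hg.differentiable one_ne_zero) z) (fun z hz => hL z (by simpa using hz))
    (by simpa using hy) (by simpa using hx)

theorem exists_backward_difference_bound {Φ : V → ℝ} (hΦ : ContDiff ℝ 2 Φ) {c : ℝ} (hc : 0 ≤ c) :
    ∃ K, 0 ≤ K ∧ ∀ (h : ℝ) (a a0 v v0 : V), 0 < h → h ≤ 1 → ‖a - a0‖ ≤ c * h →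
      ‖v - v0‖ ≤ c * h → ‖a0‖ ≤ c → ‖v0‖ ≤ c →
      |(Φ a - Φ (a - h • v)) / h - fderiv ℝ Φ a0 v0| ≤ K * h := by
  have hΦ' : ContDiff ℝ 1 (fderiv ℝ Φ) := hΦ.fderiv_right (by norm_num)
  obtain ⟨L, hL0, hL⟩ := exists_lipschitz_closedBall hΦ' (4 * c)
  obtain ⟨B, hB0, hB⟩ := exists_bound_closedBall hΦ'.continuous c
  refine ⟨L * (3 * c) * (2 * c) + B * c, by positivity, fun h a a0 v v0 hh h1 ha hv ha0 hv0 => ?_⟩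
  have hch : c * h ≤ c := by nlinarith
  have hvn : ‖v‖ ≤ 2 * c := by
    have := norm_add_le (v - v0) v0
    rw [sub_add_cancel] at this
    linarith
  have hhv : ‖h • v‖ ≤ 2 * c * h := by
    rw [norm_smul, Real.norm_of_nonneg hh.le]
    nlinarith
  have hb : ‖(a - h • v) - a0‖ ≤ 3 * c * h := by
    have := norm_sub_le (a - a0) (h • v)
    rw [show a - h • v - a0 = a - a0 - h • v by abel]
    linarith
  have key := (convex_closedBall a0 (3 * c * h)).norm_image_sub_le_of_norm_fderiv_le'
    (f := Φ) (φ := fderiv ℝ Φ a0) (C := L * (3 * c * h)) (x := a - h • v) (y := a)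
    (fun z _ => (hΦ.differentiable two_ne_zero) z)
    (fun z hz => by
      rw [mem_closedBall_iff_norm] at hz
      refine (hL z a0 ?_ (by linarith)).trans (mul_le_mul_of_nonneg_left hz hL0)
      have := norm_add_le (z - a0) a0
      rw [sub_add_cancel] at this
      linarith)
    (by rwa [mem_closedBall_iff_norm])
    (by rw [mem_closedBall_iff_norm]; nlinarith)
  rw [sub_sub_cancel, map_smul, Real.norm_eq_abs, smul_eq_mul] at key
  have h2 : |fderiv ℝ Φ a0 (v - v0)| ≤ B * (c * h) :=
    ((fderiv ℝ Φ a0).le_opNorm _).trans (mul_le_mul (hB a0 ha0) hv (norm_nonneg _) hB0)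
  have h3 : |(Φ a - Φ (a - h • v)) / h - fderiv ℝ Φ a0 v| ≤ L * (3 * c) * (2 * c) * h := by
    rw [show (Φ a - Φ (a - h • v)) / h - fderiv ℝ Φ a0 v =
      (Φ a - Φ (a - h • v) - h * fderiv ℝ Φ a0 v) / h by field_simp, abs_div, abs_of_pos hh,
      div_le_iff₀ hh]
    calc _ ≤ _ := key
      _ ≤ L * (3 * c * h) * (2 * c * h) := mul_le_mul_of_nonneg_left hhv (by positivity)
      _ = _ := by ring
  rw [show (Φ a - Φ (a - h • v)) / h - fderiv ℝ Φ a0 v0 =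
    ((Φ a - Φ (a - h • v)) / h - fderiv ℝ Φ a0 v) + fderiv ℝ Φ a0 (v - v0) by
      rw [map_sub]; ring]
  calc _ ≤ _ := abs_add_le _ _
    _ ≤ L * (3 * c) * (2 * c) * h + B * (c * h) := add_le_add h3 h2
    _ = _ := by ring

end Calculus

/-! ### Consistency of difference quotients -/

/-- The `i`-th partial derivative. -/
def pd (i : Fin d) (g : (Fin d → ℝ) → ℝ) (x : Fin d → ℝ) : ℝ := fderiv ℝ g x (bv d i)

theorem norm_bv (i : Fin d) : ‖bv d i‖ = 1 := by
  simp [bv, Pi.norm_single]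

theorem contDiff_pd {n m : WithTop ℕ∞} {g : (Fin d → ℝ) → ℝ} (hg : ContDiff ℝ n g)
    (hmn : m + 1 ≤ n) (i : Fin d) : ContDiff ℝ m (pd i g) :=
  (hg.fderiv_right hmn).clm_apply contDiff_const

theorem pd_pd_apply {g : (Fin d → ℝ) → ℝ} (hg : ContDiff ℝ 2 g) (i j : Fin d) (x : Fin d → ℝ) :
    pd i (pd j g) x = fderiv ℝ (fderiv ℝ g) x (bv d i) (bv d j) := by
  have h : DifferentiableAt ℝ (fderiv ℝ g) x :=
    (hg.fderiv_right (m := 1) (by norm_num)).differentiable one_ne_zero x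
  unfold pd
  rw [fderiv_clm_apply h (differentiableAt_const _)]
  simp

theorem pd_comm {g : (Fin d → ℝ) → ℝ} (hg : ContDiff ℝ 2 g) (i j : Fin d) :
    pd i (pd j g) = pd j (pd i g) := by
  ext x
  rw [pd_pd_apply hg, pd_pd_apply hg]
  exact (hg.contDiffAt.isSymmSndFDerivAt (by simp)) _ _

theorem hess_apply {g : (Fin d → ℝ) → ℝ} (hg : ContDiff ℝ 2 g) (x : Fin d → ℝ) (i j : Fin d) :
    hess g x i j = pd i (pd j g) x := by
  rw [pd_pd_apply hg, hess, Matrix.of_apply, iteratedFDeriv_two_apply]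
  rfl

theorem dm_eq_dp (h : ℝ) (i : Fin d) (g : (Fin d → ℝ) → ℝ) (x : Fin d → ℝ) :
    dm h i g x = dp h i g (x - h • bv d i) := by
  simp [dm, dp]

theorem differentiable_dp {g : (Fin d → ℝ) → ℝ} (hg : Differentiable ℝ g) (h : ℝ) (i : Fin d) :
    Differentiable ℝ (dp h i g) := by
  unfold dp
  fun_prop

theorem differentiable_dm {g : (Fin d → ℝ) → ℝ} (hg : Differentiable ℝ g) (h : ℝ) (i : Fin d) :
    Differentiable ℝ (dm h i g) := by
  unfold dm
  fun_prop

theorem pd_dp {g : (Fin d → ℝ) → ℝ} (hg : Differentiable ℝ g) (h : ℝ) (i j : Fin d) :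
    pd j (dp h i g) = dp h i (pd j g) := by
  ext x
  simp only [pd]
  unfold dp
  simp only [div_eq_inv_mul]
  rw [fderiv_const_mul (by fun_prop), fderiv_fun_sub (by fun_prop) (by fun_prop),
    fderiv_comp_add_right]
  rfl

theorem pd_dm {g : (Fin d → ℝ) → ℝ} (hg : Differentiable ℝ g) (h : ℝ) (i j : Fin d) :
    pd j (dm h i g) = dm h i (pd j g) := by
  ext x
  simp only [pd]
  unfold dm
  simp only [div_eq_inv_mul, sub_eq_add_neg x, sub_eq_add_neg (_ : Fin d → ℝ)]
  rw [fderiv_const_mul (by fun_prop), fderiv_fun_sub (by fun_prop) (by fun_prop),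
    fderiv_comp_add_right]
  rfl

theorem exists_dp_eq_pd {g : (Fin d → ℝ) → ℝ} (hg : Differentiable ℝ g) {h : ℝ} (hh : 0 < h)
    (i : Fin d) (x : Fin d → ℝ) :
    ∃ t ∈ Set.Icc (0 : ℝ) 1, dp h i g x = pd i g (x + (t * h) • bv d i) := by
  obtain ⟨z, hz, hgz⟩ := domain_mvt (f := g) (s := Set.univ) (x := x) (y := x + h • bv d i)
    (fun y _ => (hg y).hasFDerivAt.hasFDerivWithinAt) convex_univ trivial trivial
  rw [segment_eq_image'] at hz
  obtain ⟨t, ht, rfl⟩ := hz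
  refine ⟨t, ht, ?_⟩
  rw [dp, hgz, add_sub_cancel_left, map_smul, smul_eq_mul, mul_div_cancel_left₀ _ hh.ne', pd]
  simp only [smul_smul]

theorem norm_smul_bv {t h : ℝ} (ht : t ∈ Set.Icc (0 : ℝ) 1) (hh : 0 < h) (i : Fin d) :
    ‖(t * h) • bv d i‖ ≤ h := by
  rw [norm_smul, norm_bv, mul_one, Real.norm_of_nonneg (mul_nonneg ht.1 hh.le)]
  nlinarith [ht.2]

theorem exists_near_dp {g : (Fin d → ℝ) → ℝ} (hg : Differentiable ℝ g) {h : ℝ} (hh : 0 < h)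
    (i : Fin d) (x : Fin d → ℝ) :
    ∃ y, ‖y - x‖ ≤ h ∧ dp h i g x = pd i g y := by
  obtain ⟨t, ht, h1⟩ := exists_dp_eq_pd hg hh i x
  exact ⟨_, by rw [add_sub_cancel_left]; exact norm_smul_bv ht hh i, h1⟩

theorem exists_near_dm {g : (Fin d → ℝ) → ℝ} (hg : Differentiable ℝ g) {h : ℝ} (hh : 0 < h)
    (i : Fin d) (x : Fin d → ℝ) :
    ∃ y, ‖y - x‖ ≤ h ∧ dm h i g x = pd i g y := by
  obtain ⟨t, ht, h1⟩ := exists_dp_eq_pd hg hh i (x - h • bv d i)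
  refine ⟨_, ?_, (dm_eq_dp h i g x).trans h1⟩
  rw [show x - h • bv d i + (t * h) • bv d i - x = -(((1 - t) * h) • bv d i) by module, norm_neg]
  exact norm_smul_bv ⟨by linarith [ht.2], by linarith [ht.1]⟩ hh i

theorem exists_near_dm_dp {g : (Fin d → ℝ) → ℝ} (hg : ContDiff ℝ 2 g) {h : ℝ} (hh : 0 < h)
    (i j : Fin d) (x : Fin d → ℝ) :
    ∃ y, ‖y - x‖ ≤ 2 * h ∧ dm h j (dp h i g) x = pd i (pd j g) y := by
  have hg1 : Differentiable ℝ g := hg.differentiable two_ne_zero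
  obtain ⟨y, hy, e1⟩ := exists_near_dm (differentiable_dp hg1 h i) hh j x
  rw [pd_dp hg1] at e1
  obtain ⟨w, hw, e2⟩ := exists_near_dp
    ((contDiff_pd (m := 1) hg (by norm_num) j).differentiable one_ne_zero) hh i y
  refine ⟨w, ?_, e1.trans e2⟩
  have := norm_add_le (w - y) (y - x)
  rw [sub_add_sub_cancel] at this
  linarith

theorem exists_near_dm_dm_dp {g : (Fin d → ℝ) → ℝ} (hg : ContDiff ℝ 3 g) {h : ℝ} (hh : 0 < h)
    (i j k : Fin d) (x : Fin d → ℝ) :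
    ∃ y, ‖y - x‖ ≤ 3 * h ∧ dm h k (dm h j (dp h i g)) x = pd i (pd j (pd k g)) y := by
  have hg1 : Differentiable ℝ g := hg.differentiable three_ne_zero
  obtain ⟨y, hy, e1⟩ := exists_near_dm (differentiable_dm (differentiable_dp hg1 h i) h j) hh k x
  rw [pd_dm (differentiable_dp hg1 h i), pd_dp hg1] at e1
  obtain ⟨w, hw, e2⟩ := exists_near_dm_dp (contDiff_pd (m := 2) hg (by norm_num) k) hh i j y
  refine ⟨w, ?_, e1.trans e2⟩
  have := norm_add_le (w - y) (y - x)
  rw [sub_add_sub_cancel] at this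
  linarith

/-- `F h` approximates `F₀` to first order in `h`, uniformly on bounded sets. -/
def Consistent (F : ℝ → (Fin d → ℝ) → ℝ) (F₀ : (Fin d → ℝ) → ℝ) : Prop :=
  ∀ R : ℝ, ∃ C, 0 ≤ C ∧ ∀ h x, 0 < h → h ≤ 1 → ‖x‖ ≤ R → |F h x - F₀ x| ≤ C * h

theorem consistent_of_exists_near {F : ℝ → (Fin d → ℝ) → ℝ} {g : (Fin d → ℝ) → ℝ}
    (hg : ContDiff ℝ 1 g) {k : ℝ} (hk : 0 ≤ k)
    (hF : ∀ h x, 0 < h → ∃ y, ‖y - x‖ ≤ k * h ∧ F h x = g y) : Consistent F g := by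
  intro R
  obtain ⟨L, hL0, hL⟩ := exists_lipschitz_closedBall hg (R + k)
  refine ⟨L * k, by positivity, fun h x hh h1 hx => ?_⟩
  obtain ⟨y, hy, e⟩ := hF h x hh
  have hyn := norm_add_le (y - x) x
  rw [sub_add_cancel] at hyn
  rw [e, mul_assoc]
  exact (hL y x (by nlinarith) (by linarith)).trans (mul_le_mul_of_nonneg_left hy hL0)

theorem Consistent.average {F G : ℝ → (Fin d → ℝ) → ℝ} {F₀ : (Fin d → ℝ) → ℝ}
    (hF : Consistent F F₀) (hG : Consistent G F₀) :
    Consistent (fun h x => 1 / 2 * (F h x + G h x)) F₀ := by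
  intro R
  obtain ⟨C, hC0, hC⟩ := hF R
  obtain ⟨D, hD0, hD⟩ := hG R
  refine ⟨C + D, by positivity, fun h x hh h1 hx => ?_⟩
  have h2 := hC h x hh h1 hx
  have h3 := hD h x hh h1 hx
  rw [abs_le] at *
  have : 0 ≤ C * h := by positivity
  have : 0 ≤ D * h := by positivity
  constructor <;> linarith

theorem consistent_pi {ι : Type*} [Fintype ι] {F : ι → ℝ → (Fin d → ℝ) → ℝ}
    {F₀ : ι → (Fin d → ℝ) → ℝ} (hF : ∀ a, Consistent (F a) (F₀ a)) (R : ℝ) :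
    ∃ C, 0 ≤ C ∧ ∀ a h x, 0 < h → h ≤ 1 → ‖x‖ ≤ R → |F a h x - F₀ a x| ≤ C * h := by
  choose C hC0 hC using fun a => hF a R
  refine ⟨∑ a, C a, Finset.sum_nonneg fun a _ => hC0 a, fun a h x hh h1 hx => ?_⟩
  exact (hC a h x hh h1 hx).trans (mul_le_mul_of_nonneg_right
    (Finset.single_le_sum (fun b _ => hC0 b) (Finset.mem_univ a)) hh.le)

/-- The discrete Hessian of `u` with its `i`-th row replaced by the discrete gradient; the `i`-th
component of `(cof sym H_d u) D_h u` is its determinant. -/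
def fluxMatrix (u : (Fin d → ℝ) → ℝ) (i : Fin d) (h : ℝ) (x : Fin d → ℝ) :
    Fin d → Fin d → ℝ :=
  (symPart (Hd h u x)).updateRow i (Dh h u x)

/-- The limit of the entries of `fluxMatrix` as `h` tends to `0`. -/
def fluxLimit (u : (Fin d → ℝ) → ℝ) (i k l : Fin d) : (Fin d → ℝ) → ℝ :=
  if k = i then pd l u else pd k (pd l u)

theorem symPart_Hd_apply (h : ℝ) (u : (Fin d → ℝ) → ℝ) (x : Fin d → ℝ) (k l : Fin d) :
    symPart (Hd h u x) k l = 1 / 2 * (dm h l (dp h k u) x + dm h k (dp h l u) x) := by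
  simp [symPart, Hd]

theorem consistent_fluxMatrix {u : (Fin d → ℝ) → ℝ} (hu : ContDiff ℝ 4 u) (i k l : Fin d) :
    Consistent (fun h x => fluxMatrix u i h x k l) (fluxLimit u i k l) := by
  have hu1 : Differentiable ℝ u := hu.differentiable four_ne_zero
  have hu2 : ContDiff ℝ 2 u := hu.of_le (by norm_num)
  have h1 : ∀ a, ContDiff ℝ 3 (pd a u) := contDiff_pd hu (by norm_num)
  have h2 : ∀ a b, ContDiff ℝ 2 (pd b (pd a u)) := fun a => contDiff_pd (h1 a) (by norm_num)
  have hH : ∀ a b, Consistent (fun h x => dm h b (dp h a u) x) (pd a (pd b u)) := fun a b =>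
    consistent_of_exists_near ((h2 b a).of_le (by norm_num)) zero_le_two
      fun h x hh => exists_near_dm_dp hu2 hh a b x
  by_cases hk : k = i
  · simp only [fluxMatrix, fluxLimit, Matrix.updateRow_apply, hk, if_true]
    refine consistent_of_exists_near ((h1 l).of_le (by norm_num)) zero_le_one fun h x hh => ?_
    simpa [Dh] using exists_near_dp hu1 hh l x
  · simp only [fluxMatrix, fluxLimit, Matrix.updateRow_apply, hk, if_false, symPart_Hd_apply]
    exact (hH k l).average (pd_comm hu2 l k ▸ hH l k)

theorem consistent_dm_fluxMatrix {u : (Fin d → ℝ) → ℝ} (hu : ContDiff ℝ 4 u) (i k l : Fin d) :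
    Consistent (fun h x => dm h i (fun y => fluxMatrix u i h y k l) x)
      (pd i (fluxLimit u i k l)) := by
  have hu2 : ContDiff ℝ 2 u := hu.of_le (by norm_num)
  have hu3 : ContDiff ℝ 3 u := hu.of_le (by norm_num)
  have h1 : ∀ a, ContDiff ℝ 3 (pd a u) := contDiff_pd hu (by norm_num)
  have h2 : ∀ a b, ContDiff ℝ 2 (pd b (pd a u)) := fun a => contDiff_pd (h1 a) (by norm_num)
  by_cases hk : k = i
  · simp only [fluxMatrix, fluxLimit, Matrix.updateRow_apply, hk, if_true]
    refine consistent_of_exists_near ((h2 l i).of_le (by norm_num)) zero_le_two fun h x hh => ?_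
    rw [pd_comm hu2 i l]
    exact exists_near_dm_dp hu2 hh l i x
  · simp only [fluxMatrix, fluxLimit, Matrix.updateRow_apply, hk, if_false, symPart_Hd_apply]
    have h3 : ContDiff ℝ 1 (pd i (pd k (pd l u))) := contDiff_pd (h2 l k) (by norm_num) i
    have e1 : pd i (pd k (pd l u)) = pd k (pd l (pd i u)) := by
      rw [pd_comm ((h1 l).of_le (by norm_num)) i k, pd_comm hu2 i l]
    have e2 : pd i (pd k (pd l u)) = pd l (pd k (pd i u)) := by
      rw [e1, pd_comm ((h1 i).of_le (by norm_num)) k l]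
    have hkl : Consistent (fun h x => dm h i (dm h l (dp h k u)) x) (pd i (pd k (pd l u))) :=
      consistent_of_exists_near h3 zero_le_three fun h x hh => by
        rw [e1]
        exact exists_near_dm_dm_dp hu3 hh k l i x
    have hlk : Consistent (fun h x => dm h i (dm h k (dp h l u)) x) (pd i (pd k (pd l u))) :=
      consistent_of_exists_near h3 zero_le_three fun h x hh => by
        rw [e2]
        exact exists_near_dm_dm_dp hu3 hh l k i x
    have e3 : ∀ (h : ℝ) (p q : (Fin d → ℝ) → ℝ) (x : Fin d → ℝ),
        dm h i (fun y => 1 / 2 * (p y + q y)) x = 1 / 2 * (dm h i p x + dm h i q x) := by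
      intro h p q x
      simp only [dm]
      ring
    simp only [e3]
    exact hkl.average hlk

theorem sum_fderiv_detRows_fluxLimit {u : (Fin d → ℝ) → ℝ} (hu : ContDiff ℝ 4 u)
    (x : Fin d → ℝ) :
    ∑ i, fderiv ℝ (detRows d) (fun k l => fluxLimit u i k l x)
      (fun k l => pd i (fluxLimit u i k l) x) = d * (hess u x).det := by
  have hu2 : ContDiff ℝ 2 u := hu.of_le (by norm_num)
  have h1 : ∀ a, ContDiff ℝ 3 (pd a u) := contDiff_pd hu (by norm_num)
  rw [← sum_det_updateRow_updateRow (hess u x) (fun l => pd l u x)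
    (fun i k l => pd i (pd k (pd l u)) x)
    (fun i k => funext fun l => by rw [pd_comm ((h1 l).of_le (by norm_num)) i k])]
  refine Finset.sum_congr rfl fun i _ => ?_
  rw [fderiv_detRows]
  refine Finset.sum_congr rfl fun k _ => ?_
  congr 1
  ext a b
  simp only [Matrix.updateRow_apply, Matrix.of_apply, fluxLimit, hess_apply hu2]
  split_ifs <;> simp_all [hess_apply hu2]

theorem MAh_eq (h : ℝ) (u : (Fin d → ℝ) → ℝ) (x : Fin d → ℝ) :
    MAh h u x = 1 / (d : ℝ) * ∑ i, dm h i (fun y => detRows d (fluxMatrix u i h y)) x := by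
  simp only [MAh, divh, cof_mulVec_apply]
  rfl

theorem consistent_MAh (hd : d ≠ 0) {u : (Fin d → ℝ) → ℝ} (hu : ContDiff ℝ 4 u) :
    Consistent (fun h x => MAh h u x) (fun x => (hess u x).det) := by
  intro R
  have hlim : ∀ i k l, ContDiff ℝ 2 (fluxLimit u i k l) := by
    intro i k l
    have h1 : ∀ a, ContDiff ℝ 3 (pd a u) := contDiff_pd hu (by norm_num)
    unfold fluxLimit
    split_ifs
    · exact (h1 l).of_le (by norm_num)
    · exact contDiff_pd (h1 l) (by norm_num) k
  obtain ⟨C, hC0, hC⟩ := consistent_pi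
    (fun a : Fin d × Fin d × Fin d => consistent_fluxMatrix hu a.1 a.2.1 a.2.2) R
  obtain ⟨D, hD0, hD⟩ := consistent_pi
    (fun a : Fin d × Fin d × Fin d => consistent_dm_fluxMatrix hu a.1 a.2.1 a.2.2) R
  obtain ⟨B, hB0, hB⟩ := exists_bound_closedBall
    (g := fun x (i k l : Fin d) => fluxLimit u i k l x)
    (continuous_pi fun i => continuous_pi fun k => continuous_pi fun l => (hlim i k l).continuous) R
  obtain ⟨B', hB'0, hB'⟩ := exists_bound_closedBall
    (g := fun x (i k l : Fin d) => pd i (fluxLimit u i k l) x)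
    (continuous_pi fun i => continuous_pi fun k => continuous_pi fun l =>
      (contDiff_pd (m := 1) (hlim i k l) (by norm_num) i).continuous) R
  set c := C + D + B + B' with hc
  obtain ⟨K, hK0, hK⟩ := exists_backward_difference_bound
    (ContinuousMultilinearMap.contDiff (detRows d)) (show 0 ≤ c by positivity)
  refine ⟨K, hK0, fun h x hh h1 hx => ?_⟩
  have hmain : ∀ i, |dm h i (fun y => detRows d (fluxMatrix u i h y)) x -
      fderiv ℝ (detRows d) (fun k l => fluxLimit u i k l x)
      (fun k l => pd i (fluxLimit u i k l) x)| ≤ K * h := by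
    intro i
    have key := hK h (fluxMatrix u i h x) (fun k l => fluxLimit u i k l x)
      (fun k l => dm h i (fun y => fluxMatrix u i h y k l) x)
      (fun k l => pd i (fluxLimit u i k l) x) hh h1
      ((pi_norm_le_iff_of_nonneg (by positivity)).2 fun k =>
        (pi_norm_le_iff_of_nonneg (by positivity)).2 fun l =>
        (hC (i, k, l) h x hh h1 hx).trans
          (mul_le_mul_of_nonneg_right (by linarith) hh.le))
      ((pi_norm_le_iff_of_nonneg (by positivity)).2 fun k =>
        (pi_norm_le_iff_of_nonneg (by positivity)).2 fun l =>
        (hD (i, k, l) h x hh h1 hx).trans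
          (mul_le_mul_of_nonneg_right (by linarith) hh.le))
      ((norm_le_pi_norm (fun i k l => fluxLimit u i k l x) i).trans
        ((hB x hx).trans (by linarith)))
      ((norm_le_pi_norm (fun i k l => pd i (fluxLimit u i k l) x) i).trans
        ((hB' x hx).trans (by linarith)))
    have hshift : fluxMatrix u i h x -
        h • (fun k l => dm h i (fun y => fluxMatrix u i h y k l) x) =
        fluxMatrix u i h (x - h • bv d i) := by
      ext k l
      change fluxMatrix u i h x k l - h * dm h i (fun y => fluxMatrix u i h y k l) x = _
      rw [dm, mul_div_cancel₀ _ hh.ne', sub_sub_cancel]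
    rw [hshift] at key
    exact key
  have hd' : (0 : ℝ) < d := by positivity
  have hsum := sum_fderiv_detRows_fluxLimit hu x
  have e : MAh h u x - (hess u x).det =
      1 / (d : ℝ) * ∑ i, (dm h i (fun y => detRows d (fluxMatrix u i h y)) x -
      fderiv ℝ (detRows d) (fun k l => fluxLimit u i k l x)
      (fun k l => pd i (fluxLimit u i k l) x)) := by
    rw [Finset.sum_sub_distrib, hsum, MAh_eq]
    field_simp
  rw [e, abs_mul, abs_of_pos (by positivity : 0 < 1 / (d : ℝ))]
  calc _ ≤ 1 / (d : ℝ) * ∑ _i : Fin d, K * h :=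
        mul_le_mul_of_nonneg_left ((Finset.abs_sum_le_sum_abs _ _).trans
          (Finset.sum_le_sum fun i _ => hmain i)) (by positivity)
    _ = K * h := by
        simp
        field_simp

/-! ### Summation by parts and the discrete Poincaré inequality -/

section Energy

theorem summable_mul_of_hasFiniteSupport {G : Type*} {W : G → ℝ} (hW : W.HasFiniteSupport)
    (F : G → ℝ) : Summable fun x => W x * F x :=
  summable_of_hasFiniteSupport (hW.subset (Function.support_mul_subset_left W F))

variable {G : Type*} [AddCommGroup G]

theorem summable_shift {F : G → ℝ} (hF : Summable F) (e : G) : Summable fun x => F (x + e) :=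
  (Equiv.addRight e).summable_iff.2 hF

theorem tsum_shift (F : G → ℝ) (e : G) : ∑' x, F (x + e) = ∑' x, F x :=
  (Equiv.addRight e).tsum_eq F

theorem summable_sq_sub_shift {W : G → ℝ} (hW : W.HasFiniteSupport) (e : G) :
    Summable fun x => (W (x + e) - W x) ^ 2 := by
  have h1 := summable_mul_of_hasFiniteSupport hW W
  have h2 := summable_mul_of_hasFiniteSupport hW (fun x => W (x + e))
  refine (((summable_shift h1 e).add h1).sub (h2.mul_left 2)).congr fun x => ?_
  ring

theorem tsum_sq_sub_shift {W : G → ℝ} (hW : W.HasFiniteSupport) (e : G) :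
    ∑' x, (W (x + e) - W x) ^ 2 = -∑' x, W x * (W (x + e) - 2 * W x + W (x - e)) := by
  have h1 := summable_mul_of_hasFiniteSupport hW W
  have h2 := summable_mul_of_hasFiniteSupport hW (fun x => W (x + e))
  have h3 := summable_mul_of_hasFiniteSupport hW (fun x => W (x - e))
  have e1 : ∑' x, W (x + e) * W (x + e) = ∑' x, W x * W x := tsum_shift (fun x => W x * W x) e
  have e2 : ∑' x, W x * W (x - e) = ∑' x, W x * W (x + e) := by
    rw [← tsum_shift _ e]
    exact tsum_congr fun x => by rw [add_sub_cancel_right, mul_comm]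
  have l : ∑' x, (W (x + e) - W x) ^ 2 =
      ∑' x, (W (x + e) * W (x + e) + W x * W x - 2 * (W x * W (x + e))) :=
    tsum_congr fun x => by ring
  have r : ∑' x, W x * (W (x + e) - 2 * W x + W (x - e)) =
      ∑' x, (W x * W (x + e) - 2 * (W x * W x) + W x * W (x - e)) :=
    tsum_congr fun x => by ring
  rw [l, r, ((summable_shift h1 e).add h1).tsum_sub (h2.mul_left 2),
    (summable_shift h1 e).tsum_add h1, (h2.sub (h1.mul_left 2)).tsum_add h3,
    h2.tsum_sub (h1.mul_left 2), tsum_mul_left, tsum_mul_left, e1, e2]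
  ring

/-- A discrete Poincaré inequality; `ξ` is a coordinate increasing by `h` under the shift by `e`. -/
theorem tsum_sq_le_tsum_sq_sub_shift {W ξ : G → ℝ} (hW : W.HasFiniteSupport) {e : G} {h ρ : ℝ}
    (hξ : ∀ x, ξ (x + e) = ξ x + h) (hρ : ∀ x, W x ≠ 0 → |ξ x| + |h| ≤ ρ) :
    h ^ 2 * ∑' x, W x ^ 2 ≤ 4 * ρ ^ 2 * ∑' x, (W (x + e) - W x) ^ 2 := by
  have h0 : Summable fun x => W x ^ 2 :=
    (summable_mul_of_hasFiniteSupport hW W).congr fun x => by ring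
  have h1 := summable_sq_sub_shift hW e
  have h2 : Summable fun x => ξ x * W x ^ 2 :=
    (summable_mul_of_hasFiniteSupport hW fun x => W x * ξ x).congr fun x => by ring
  have hsbp : h * ∑' x, W x ^ 2 = -∑' x, ξ x * (W (x + e) ^ 2 - W x ^ 2) := by
    have r : ∑' x, ξ x * (W (x + e) ^ 2 - W x ^ 2) =
        ∑' x, (ξ (x + e) * W (x + e) ^ 2 - ξ x * W x ^ 2 - h * W (x + e) ^ 2) :=
      tsum_congr fun x => by rw [hξ]; ring
    rw [r, ((summable_shift h2 e).sub h2).tsum_sub ((summable_shift h0 e).mul_left h),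
      (summable_shift h2 e).tsum_sub h2, tsum_shift (fun x => ξ x * W x ^ 2) e, tsum_mul_left,
      tsum_shift (fun x => W x ^ 2) e]
    ring
  have hpt : ∀ x, -(h * (ξ x * (W (x + e) ^ 2 - W x ^ 2))) ≤
      2 * ρ ^ 2 * (W (x + e) - W x) ^ 2 + h ^ 2 / 4 * (W (x + e) ^ 2 + W x ^ 2) := by
    intro x
    by_cases hx : |ξ x| ≤ ρ
    · have hsq : ξ x ^ 2 ≤ ρ ^ 2 := sq_le_sq' (by linarith [abs_le.1 hx]) (abs_le.1 hx).2
      nlinarith [sq_nonneg (4 * ξ x * (W (x + e) - W x) + h * (W (x + e) + W x)),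
        mul_le_mul_of_nonneg_right hsq (sq_nonneg (W (x + e) - W x)),
        mul_nonneg (sq_nonneg h) (sq_nonneg (W (x + e) - W x))]
    · have hz : W x = 0 := by
        by_contra hne
        linarith [hρ x hne, abs_nonneg h, not_le.1 hx]
      have hz' : W (x + e) = 0 := by
        by_contra hne
        have h3 := hρ _ hne
        have h4 := abs_sub (ξ x + h) h
        rw [hξ] at h3
        rw [add_sub_cancel_right] at h4
        linarith [not_le.1 hx]
      simp [hz, hz']
  have h5 : Summable fun x => ξ x * (W (x + e) ^ 2 - W x ^ 2) := by
    refine (((summable_shift h2 e).sub h2).sub ((summable_shift h0 e).mul_left h)).congr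
      fun x => ?_
    rw [hξ]
    ring
  have hle := Summable.tsum_le_tsum hpt (h5.mul_left h).neg
    ((h1.mul_left (2 * ρ ^ 2)).add (((summable_shift h0 e).add h0).mul_left (h ^ 2 / 4)))
  rw [tsum_neg, tsum_mul_left,
    (h1.mul_left (2 * ρ ^ 2)).tsum_add (((summable_shift h0 e).add h0).mul_left (h ^ 2 / 4)),
    tsum_mul_left, tsum_mul_left, (summable_shift h0 e).tsum_add h0,
    tsum_shift (fun x => W x ^ 2) e, ← mul_neg, ← hsbp] at hle
  linarith

/-- The energy estimate for the discrete Poisson equation `Δ W = g` on the support of `W`. -/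
theorem tsum_energy_le {ι : Type*} [Fintype ι] (i₀ : ι) {W ξ g : G → ℝ} {S : Finset G}
    (hW : ∀ x ∉ S, W x = 0) {e : ι → G} {h ρ δ : ℝ} (hh : 0 < h)
    (hξ : ∀ x, ξ (x + e i₀) = ξ x + h) (hρ : ∀ x ∈ S, |ξ x| + h ≤ ρ) (hρ0 : 0 < ρ)
    (hg : ∀ x ∈ S, |g x| ≤ δ)
    (heq : ∀ x ∈ S, ∑ i, (W (x + e i) - 2 * W x + W (x - e i)) = h ^ 2 * g x) :
    ∑ i, ∑' x, (W (x + e i) - W x) ^ 2 ≤ h ^ 2 * (4 * ρ ^ 2 * δ ^ 2 * S.card) := by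
  have hfin : W.HasFiniteSupport :=
    S.finite_toSet.subset fun x hx => by
      by_contra hxS
      exact hx (hW x hxS)
  set E := ∑ i, ∑' x, (W (x + e i) - W x) ^ 2 with hE
  have hE1 : ∑' x, (W (x + e i₀) - W x) ^ 2 ≤ E :=
    Finset.single_le_sum (f := fun i => ∑' x, (W (x + e i) - W x) ^ 2)
      (fun i _ => tsum_nonneg fun x => sq_nonneg _) (Finset.mem_univ i₀)
  have hP := tsum_sq_le_tsum_sq_sub_shift hfin hξ (ρ := ρ) fun x hx => by
    rw [abs_of_pos hh]
    exact hρ x (by by_contra hxS; exact hx (hW x hxS))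
  have hsumW : ∑' x, W x ^ 2 = ∑ x ∈ S, W x ^ 2 :=
    tsum_eq_sum fun x hx => by rw [hW x hx]; ring
  have hEq : E = -∑ x ∈ S, W x * (h ^ 2 * g x) := by
    have h1 : ∀ i, ∑' x, (W (x + e i) - W x) ^ 2 =
        -∑ x ∈ S, W x * (W (x + e i) - 2 * W x + W (x - e i)) := fun i => by
      rw [tsum_sq_sub_shift hfin, tsum_eq_sum fun x hx => by rw [hW x hx, zero_mul]]
    rw [hE, Finset.sum_congr rfl fun i _ => h1 i, Finset.sum_neg_distrib, Finset.sum_comm]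
    congr 1
    refine Finset.sum_congr rfl fun x hx => ?_
    rw [← Finset.mul_sum, heq x hx]
  have hpt : ∀ x ∈ S, -(W x * (h ^ 2 * g x)) * (8 * ρ ^ 2) ≤
      h ^ 2 * W x ^ 2 + h ^ 2 * (16 * ρ ^ 4 * δ ^ 2) := by
    intro x hx
    have hsq : g x ^ 2 ≤ δ ^ 2 :=
      sq_le_sq' (by linarith [abs_le.1 (hg x hx)]) (abs_le.1 (hg x hx)).2
    have : 16 * ρ ^ 4 * g x ^ 2 ≤ 16 * ρ ^ 4 * δ ^ 2 := by gcongr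
    nlinarith [mul_nonneg (sq_nonneg h) (sq_nonneg (W x + 4 * ρ ^ 2 * g x)),
      mul_le_mul_of_nonneg_left this (sq_nonneg h)]
  have hsum := Finset.sum_le_sum hpt
  rw [← Finset.sum_mul, Finset.sum_neg_distrib, ← hEq, Finset.sum_add_distrib, ← Finset.mul_sum,
    ← hsumW, Finset.sum_const, nsmul_eq_mul] at hsum
  have h4 : 4 * ρ ^ 2 * E ≤ 4 * ρ ^ 2 * (h ^ 2 * (4 * ρ ^ 2 * δ ^ 2 * S.card)) := by
    have := mul_le_mul_of_nonneg_left hE1 (by positivity : 0 ≤ 4 * ρ ^ 2)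
    nlinarith
  exact le_of_mul_le_mul_left h4 (by positivity)

end Energy

/-! ### Counting grid points -/

theorem exists_finset_grid {A : Set (Fin d → ℝ)} {h R : ℝ} (hh : 0 < h) (h1 : h ≤ 1) (hR : 0 ≤ R)
    (hA : A ⊆ gridZ d h) (hb : ∀ x ∈ A, ‖x‖ ≤ R) :
    ∃ S : Finset (Fin d → ℝ), (S : Set (Fin d → ℝ)) = A ∧ h ^ d * S.card ≤ (2 * R + 1) ^ d := by
  classical
  set m : ℕ := ⌊R / h⌋₊ with hm
  set T : Finset (Fin d → ℝ) := (Fintype.piFinset fun _ : Fin d => Finset.Icc (-(m : ℤ)) m).image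
    fun k i => (k i : ℝ) * h with hT
  have hAT : A ⊆ T := by
    intro x hx
    choose k hk using hA hx
    have hkm : ∀ i, |k i| ≤ m := by
      intro i
      have h2 : |x i| ≤ R := (norm_le_pi_norm x i).trans (hb x hx)
      rw [hk i, abs_mul, abs_of_pos hh, ← le_div_iff₀ hh] at h2
      have h3 : ((k i).natAbs : ℝ) ≤ R / h := by
        rwa [Nat.cast_natAbs, Int.cast_abs]
      rw [Int.abs_eq_natAbs]
      exact_mod_cast Nat.le_floor h3
    simp only [hT, Finset.coe_image, Set.mem_image, Finset.mem_coe, Fintype.mem_piFinset,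
      Finset.mem_Icc]
    exact ⟨k, fun i => abs_le.1 (hkm i), funext fun i => (hk i).symm⟩
  have hfin : A.Finite := T.finite_toSet.subset hAT
  refine ⟨hfin.toFinset, hfin.coe_toFinset, ?_⟩
  have hcard : hfin.toFinset.card ≤ (2 * m + 1) ^ d := by
    refine (Finset.card_le_card fun x hx => hAT (by simpa using hx)).trans
      (Finset.card_image_le.trans ?_)
    rw [Fintype.card_piFinset]
    simp only [Int.card_Icc, Finset.prod_const, Finset.card_univ, Fintype.card_fin]
    exact Nat.pow_le_pow_left (by omega) d
  have hmh : (m : ℝ) * h ≤ R := by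
    rw [← le_div_iff₀ hh]
    exact Nat.floor_le (by positivity)
  calc h ^ d * (hfin.toFinset.card : ℝ) ≤ h ^ d * (2 * m + 1) ^ d := by
        gcongr
        exact_mod_cast hcard
    _ = (2 * (m * h) + h) ^ d := by rw [← mul_pow]; ring
    _ ≤ (2 * R + 1) ^ d := by gcongr

theorem add_smul_bv_mem_gridZ {h : ℝ} {x : Fin d → ℝ} (hx : x ∈ gridZ d h) (i : Fin d) :
    x + h • bv d i ∈ gridZ d h := by
  intro j
  obtain ⟨k, hk⟩ := hx j
  by_cases hj : j = i
  · exact ⟨k + 1, by subst hj; simp [bv, hk]; ring⟩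
  · exact ⟨k, by simp [bv, hk, hj]⟩

theorem sub_smul_bv_mem_gridZ {h : ℝ} {x : Fin d → ℝ} (hx : x ∈ gridZ d h) (i : Fin d) :
    x - h • bv d i ∈ gridZ d h := by
  intro j
  obtain ⟨k, hk⟩ := hx j
  by_cases hj : j = i
  · exact ⟨k - 1, by subst hj; simp [bv, hk]; ring⟩
  · exact ⟨k, by simp [bv, hk, hj]⟩

theorem lapH_eq {h : ℝ} (hh : 0 < h) (v : (Fin d → ℝ) → ℝ) (x : Fin d → ℝ) :
    h ^ 2 * lapH h v x = ∑ i, (v (x + h • bv d i) - 2 * v x + v (x - h • bv d i)) := by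
  rw [lapH, Finset.mul_sum]
  refine Finset.sum_congr rfl fun i _ => ?_
  simp only [dp, dm, add_sub_cancel_right]
  field_simp
  ring

/-- The energy estimate in the discrete seminorm for a grid function `w` vanishing off `A`. -/
theorem sum_sq_dp_le (i₀ : Fin d) {A : Set (Fin d → ℝ)} {h R δ : ℝ} (hh : 0 < h) (h1 : h ≤ 1)
    (hR : 0 ≤ R) (hA : A ⊆ gridZ d h) (hb : ∀ x ∈ A, ‖x‖ ≤ R) {w : (Fin d → ℝ) → ℝ}
    (hw : ∀ x ∈ gridZ d h, x ∉ A → w x = 0) (hlap : ∀ x ∈ A, |lapH h w x| ≤ δ) :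
    ∑ i : Fin d, h ^ d * ∑ᶠ x ∈ A, (dp h i w x) ^ 2 ≤
      4 * (R + 1) ^ 2 * (2 * R + 1) ^ d * δ ^ 2 := by
  classical
  obtain ⟨S, hSA, hcard⟩ := exists_finset_grid hh h1 hR hA hb
  have hmem : ∀ x, x ∈ S ↔ x ∈ A := fun x => by rw [← hSA, Finset.mem_coe]
  set W : (Fin d → ℝ) → ℝ := fun x => if x ∈ S then w x else 0 with hWdef
  have hWw : ∀ x ∈ gridZ d h, W x = w x := by
    intro x hx
    by_cases hxS : x ∈ S
    · simp [hWdef, hxS]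
    · simp [hWdef, hxS, hw x hx (mt (hmem x).2 hxS)]
  have hW0 : ∀ x ∉ S, W x = 0 := fun x hx => by simp [hWdef, hx]
  have henergy := tsum_energy_le i₀ (ξ := fun x => x i₀) (g := lapH h w) (e := fun i => h • bv d i)
    (ρ := R + 1) hW0 hh (fun x => by simp [bv])
    (fun x hx => by
      have := (norm_le_pi_norm x i₀).trans (hb x ((hmem x).1 hx))
      rw [Real.norm_eq_abs] at this
      linarith) (by positivity) (fun x hx => hlap x ((hmem x).1 hx))
    (fun x hx => by
      have hxg := hA ((hmem x).1 hx)
      rw [lapH_eq hh, hWw x hxg]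
      exact Finset.sum_congr rfl fun i _ => by
        rw [hWw _ (add_smul_bv_mem_gridZ hxg i), hWw _ (sub_smul_bv_mem_gridZ hxg i)])
  have hfin : W.HasFiniteSupport :=
    S.finite_toSet.subset fun x hx => by
      by_contra hxS
      exact hx (hW0 x hxS)
  have hi : ∀ i, h ^ 2 * ∑ᶠ x ∈ A, (dp h i w x) ^ 2 ≤
      ∑' x, (W (x + h • bv d i) - W x) ^ 2 := by
    intro i
    rw [finsum_mem_congr hSA.symm fun x _ => rfl, finsum_mem_coe_finset, Finset.mul_sum]
    refine le_trans (le_of_eq ?_) ((summable_sq_sub_shift hfin (h • bv d i)).sum_le_tsum S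
      fun x _ => sq_nonneg _)
    refine Finset.sum_congr rfl fun x hx => ?_
    have hxg := hA ((hmem x).1 hx)
    rw [hWw _ (add_smul_bv_mem_gridZ hxg i), hWw x hxg, dp]
    field_simp
  have hsum : h ^ 2 * ∑ i : Fin d, ∑ᶠ x ∈ A, (dp h i w x) ^ 2 ≤
      h ^ 2 * (4 * (R + 1) ^ 2 * δ ^ 2 * S.card) := by
    rw [Finset.mul_sum]
    exact (Finset.sum_le_sum fun i _ => hi i).trans henergy
  have hsum' := le_of_mul_le_mul_left hsum (by positivity)
  rw [← Finset.mul_sum]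
  calc _ ≤ h ^ d * (4 * (R + 1) ^ 2 * δ ^ 2 * S.card) := by gcongr
    _ = 4 * (R + 1) ^ 2 * δ ^ 2 * (h ^ d * S.card) := by ring
    _ ≤ 4 * (R + 1) ^ 2 * δ ^ 2 * (2 * R + 1) ^ d := by gcongr
    _ = _ := by ring

end MA

/-- Lemma `mov-ball`: the fixed point map moves the center `α r_h u`
by at most `(C₁/ν) α^d h` in the discrete `H¹` seminorm. -/
theorem stmt11 {d : ℕ} (hd : 2 ≤ d) (Ω : Set (Fin d → ℝ))
    (hΩo : IsOpen Ω) (hΩc : Convex ℝ Ω) (hΩb : Bornology.IsBounded Ω)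
    (u : (Fin d → ℝ) → ℝ) (hu : ContDiff ℝ 4 u)
    (hpd : ∀ x ∈ closure Ω, (MA.hess u x).PosDef)
    (f : (Fin d → ℝ) → ℝ) (hf : ∀ x, f x = (MA.hess u x).det) :
    ∃ C1 h0 : ℝ, 0 < C1 ∧ 0 < h0 ∧ h0 < 1 ∧
      ∀ h : ℝ, 0 < h → h ≤ h0 → ∀ α : ℝ, 0 < α → ∀ ν : ℝ, 0 < ν →
        ∀ z : (Fin d → ℝ) → ℝ,
          (∀ x ∈ MA.gridZ d h, x ∉ MA.OmegaH0 Ω h → z x = α * u x) →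
          (∀ x ∈ MA.OmegaH0 Ω h,
            -ν * MA.lapH h z x =
              -ν * α * MA.lapH h u x + α ^ d * (MA.MAh h u x - f x)) →
          MA.snorm1h Ω h (fun x => z x - α * u x) ≤ (C1 / ν) * α ^ d * h := by
  have hd0 : d ≠ 0 := by omega
  obtain ⟨R, hR0, hR⟩ := hΩb.closure.exists_pos_norm_le
  obtain ⟨C, hC0, hC⟩ := MA.consistent_MAh hd0 hu R
  set B := 4 * (R + 1) ^ 2 * (2 * R + 1) ^ d with hB
  have hB0 : 0 < B := by positivity
  refine ⟨√B * (C + 1), 1 / 2, by positivity, by norm_num, by norm_num,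
    fun h hh hh0 α hα ν hν z hz hlap => ?_⟩
  have h1 : h ≤ 1 := by linarith
  have hlapw : ∀ x ∈ MA.OmegaH0 Ω h,
      |MA.lapH h (fun x => z x - α * u x) x| ≤ α ^ d * (C * h) / ν := by
    intro x hx
    have hcons : |MA.MAh h u x - (MA.hess u x).det| ≤ C * h := hC h x hh h1 (hR x hx.1.1)
    rw [← hf] at hcons
    have hlin : MA.lapH h (fun x => z x - α * u x) x = MA.lapH h z x - α * MA.lapH h u x := by
      simp only [MA.lapH, MA.dp, MA.dm, Finset.mul_sum]
      rw [← Finset.sum_sub_distrib]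
      exact Finset.sum_congr rfl fun i _ => by ring
    have hval : MA.lapH h (fun x => z x - α * u x) x = -(α ^ d * (MA.MAh h u x - f x)) / ν := by
      rw [hlin, eq_div_iff hν.ne']
      linarith [hlap x hx]
    rw [hval, abs_div, abs_neg, abs_mul, abs_of_pos hν, abs_of_pos (by positivity : 0 < α ^ d)]
    gcongr
  have hest := MA.sum_sq_dp_le ⟨0, by omega⟩ hh h1 hR0.le
    (fun x hx => hx.1.2) (fun x hx => hR x hx.1.1) (A := MA.OmegaH0 Ω h)
    (w := fun x => z x - α * u x) (fun x hx hxA => by rw [hz x hx hxA, sub_self]) hlapw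
  have hnn : 0 ≤ α ^ d * (C * h) / ν := by positivity
  calc MA.snorm1h Ω h (fun x => z x - α * u x) ≤ √(B * (α ^ d * (C * h) / ν) ^ 2) :=
        Real.sqrt_le_sqrt hest
    _ = √B * (α ^ d * (C * h) / ν) := by rw [Real.sqrt_mul hB0.le, Real.sqrt_sq hnn]
    _ ≤ √B * (α ^ d * ((C + 1) * h) / ν) := by gcongr; linarith
    _ = √B * (C + 1) / ν * α ^ d * h := by ring
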